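/- For every integer q ≥ 2, an SYK graph G satisfies F(G) ≥ F(G') for every SYK graph G' with |V(G')| = |V(G)| if and only if G is melonic. -/

import Mathlib

namespace SYK

/-- A pre-SYK graph: a finite nonempty vertex set `V`, darts `V × Fin q`
(`Fin q` standing for the strand labels `{1,…,q}`), a fixed-point-free
involutive fermionic pairing `ferm` of the darts, and a fixed-point-free
involutive disorder pairing `dis` of the vertices.  (Connectivity of the
fermionic multigraph is *not* required.) -/
structure PreGraph (q : ℕ) where
  V : Type
  [fintypeV : Fintype V]
  [decEqV : DecidableEq V]
  [nonemptyV : Nonempty V]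
  ferm : Equiv.Perm (V × Fin q)
  dis : Equiv.Perm V
  ferm_invol : ∀ d, ferm (ferm d) = d
  ferm_fpf : ∀ d, ferm d ≠ d
  dis_invol : ∀ v, dis (dis v) = v
  dis_fpf : ∀ v, dis v ≠ v

attribute [instance] PreGraph.fintypeV PreGraph.decEqV PreGraph.nonemptyV

variable {q : ℕ}

/-- The darts of a pre-SYK graph. -/
abbrev PreGraph.Dart (H : PreGraph q) : Type := H.V × Fin q

/-- Relabelling of darts induced by a map of vertices. -/
def dartMap {q : ℕ} {α β : Type} (ι : α → β) (d : α × Fin q) : β × Fin q :=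
  (ι d.1, d.2)

/-- The involution `π̂` on darts induced by the disorder pairing:
`π̂ (v, m) = (π v, m)`. -/
def PreGraph.dishat (H : PreGraph q) : Equiv.Perm H.Dart :=
  Equiv.prodCongr H.dis (Equiv.refl (Fin q))

/-- Adjacency of vertices in the fermionic multigraph `G₀`, where fermionic
lines having a dart in `S` are deleted. -/
def PreGraph.adj0Off (H : PreGraph q) (S : Set H.Dart) (v w : H.V) : Prop :=
  ∃ m m' : Fin q, (v, m) ∉ S ∧ H.ferm (v, m) = (w, m')

/-- Adjacency of vertices in the fermionic multigraph `G₀`. -/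
def PreGraph.adj0 (H : PreGraph q) : H.V → H.V → Prop :=
  H.adj0Off ∅

/-- Connectivity of the fermionic multigraph `G₀`. -/
def PreGraph.Conn0 (H : PreGraph q) : Prop :=
  ∀ v w : H.V, Relation.ReflTransGen H.adj0 v w

/-- Adjacency of vertices in the multigraph `G⁺` (one edge per fermionic line
and one edge per disorder line), where fermionic lines having a dart in `S`
are deleted. -/
def PreGraph.adjPlusOff (H : PreGraph q) (S : Set H.Dart) (v w : H.V) : Prop :=
  H.adj0Off S v w ∨ H.dis v = w

/-- The subgroup of dart permutations generated by the fermionic pairing `τ`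
and the induced disorder involution `π̂`; faces are its orbits. -/
def PreGraph.faceGroup (H : PreGraph q) : Subgroup (Equiv.Perm H.Dart) :=
  Subgroup.closure {H.ferm, H.dishat}

/-- Two darts lie in a common face. -/
def PreGraph.SameFace (H : PreGraph q) (d₁ d₂ : H.Dart) : Prop :=
  d₁ ∈ MulAction.orbit H.faceGroup d₂

/-- `F H`: the number of faces, i.e. of orbits of `⟨τ, π̂⟩` on the darts. -/
noncomputable def PreGraph.F (H : PreGraph q) : ℕ :=
  Nat.card (MulAction.orbitRel.Quotient H.faceGroup H.Dart)

/-- The number of vertices `|V(H)|`. -/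
noncomputable def PreGraph.nV (H : PreGraph q) : ℕ :=
  Nat.card H.V

/-- `δ(H) = F(H) − (q−1)·|V(H)|/2` (the division is exact: `|V(H)|` is even). -/
noncomputable def PreGraph.delta (H : PreGraph q) : ℤ :=
  (H.F : ℤ) - ((q : ℤ) - 1) * ((H.nV / 2 : ℕ) : ℤ)

/-- `e` is a fermionic line: the set of the two darts of a `τ`-orbit. -/
def PreGraph.IsLine (H : PreGraph q) (e : Set H.Dart) : Prop :=
  ∃ d : H.Dart, e = {d, H.ferm d}

/-- The fermionic lines `e₁` and `e₂` belong to a common face. -/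
def PreGraph.LinesShareFace (H : PreGraph q) (e₁ e₂ : Set H.Dart) : Prop :=
  ∃ d₁ ∈ e₁, ∃ d₂ ∈ e₂, H.SameFace d₁ d₂

/-- Deleting the fermionic lines with a dart in `S` disconnects `G₀`. -/
def PreGraph.Disconnects0 (H : PreGraph q) (S : Set H.Dart) : Prop :=
  ¬ ∀ v w : H.V, Relation.ReflTransGen (H.adj0Off S) v w

/-- Deleting the fermionic lines with a dart in `S` disconnects `G⁺`. -/
def PreGraph.DisconnectsPlus (H : PreGraph q) (S : Set H.Dart) : Prop :=
  ¬ ∀ v w : H.V, Relation.ReflTransGen (H.adjPlusOff S) v w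

/-- `{e₁, e₂}` is a 2-cut of the multigraph `G⁺`. -/
def PreGraph.TwoCutPlus (H : PreGraph q) (e₁ e₂ : Set H.Dart) : Prop :=
  H.DisconnectsPlus (e₁ ∪ e₂)

/-- `{e₁, e₂}` is a 2-cut of the fermionic multigraph `G₀`. -/
def PreGraph.TwoCut0 (H : PreGraph q) (e₁ e₂ : Set H.Dart) : Prop :=
  H.Disconnects0 (e₁ ∪ e₂)

/-- An SYK graph: a pre-SYK graph whose fermionic multigraph `G₀` is
connected. -/
structure Graph (q : ℕ) extends PreGraph q where
  conn : toPreGraph.Conn0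

/-- `G` is (a relabelling of) the minimal graph `G_min`: two vertices `a, b`
with `π a = b` and `τ (a, m) = (b, m)` for all `m`. -/
def Graph.IsMin (G : Graph q) : Prop :=
  ∃ a b : G.V, a ≠ b ∧ (∀ v : G.V, v = a ∨ v = b) ∧ G.dis a = b ∧
    ∀ m : Fin q, G.ferm (a, m) = (b, m)

/-- `G'` is obtained from `G` by a melonic move: two new vertices `x, y` with
`π x = y` are inserted on a fermionic line `{d, τ d}` of `G`; the strand
`⟨0, _⟩ : Fin q` plays the role of the label `1` of `{1,…,q}`. -/
def Graph.MelonicMove (G G' : Graph q) : Prop :=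
  ∃ (x y : G'.V) (ι : G.V → G'.V) (d : G.V × Fin q),
    Function.Injective ι ∧ x ≠ y ∧
    (∀ v' : G'.V, (¬ ∃ v, ι v = v') ↔ (v' = x ∨ v' = y)) ∧
    G'.dis x = y ∧
    (∀ v, G'.dis (ι v) = ι (G.dis v)) ∧
    G'.ferm (dartMap ι d) = (x, ⟨0, d.2.pos⟩) ∧
    G'.ferm (y, ⟨0, d.2.pos⟩) = dartMap ι (G.ferm d) ∧
    (∀ k : Fin q, k ≠ ⟨0, d.2.pos⟩ → G'.ferm (x, k) = (y, k)) ∧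
    (∀ d' : G.V × Fin q, d' ≠ d → d' ≠ G.ferm d →
      G'.ferm (dartMap ι d') = dartMap ι (G.ferm d'))

/-- Isomorphism of SYK graphs: a bijection of darts commuting with the
fermionic pairings and the induced disorder involutions, and mapping the `q`
darts of each vertex onto the `q` darts of a single vertex. -/
def Graph.Isomorphic (G G' : Graph q) : Prop :=
  ∃ φ : (G.V × Fin q) ≃ (G'.V × Fin q),
    (∀ d, φ (G.ferm d) = G'.ferm (φ d)) ∧
    (∀ d, φ (G.toPreGraph.dishat d) = G'.toPreGraph.dishat (φ d)) ∧
    ∀ v : G.V, ∃ v' : G'.V, ∀ m : Fin q, (φ (v, m)).1 = v'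

/-- `G` is melonic: isomorphic to a graph obtained from the minimal graph
`G_min` by a finite sequence of melonic moves. -/
def Graph.IsMelonic (G : Graph q) : Prop :=
  ∃ G₀ Gn : Graph q, G₀.IsMin ∧ Relation.ReflTransGen Graph.MelonicMove G₀ Gn ∧
    G.Isomorphic Gn

/-- The pre-SYK graph obtained from `H` by replacing the fermionic pairing,
keeping the vertex set and the disorder pairing. -/
def PreGraph.withFerm (H : PreGraph q) (f : Equiv.Perm (H.V × Fin q))
    (hi : ∀ d, f (f d) = d) (hf : ∀ d, f d ≠ d) : PreGraph q where
  V := H.V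
  fintypeV := H.fintypeV
  decEqV := H.decEqV
  nonemptyV := H.nonemptyV
  ferm := f
  dis := H.dis
  ferm_invol := hi
  ferm_fpf := hf
  dis_invol := H.dis_invol
  dis_fpf := H.dis_fpf

/-- `G` is the gluing `G₁^{(e₁)} ⋆ G₂^{(e₂)}` where `e₁ = {d₁, τ₁ d₁}` and
`e₂ = {d₂, τ₂ d₂}`: the vertex set is the disjoint union of those of `G₁` and
`G₂`, the disorder pairing is the union of the two disorder pairings, and the
fermionic pairing agrees with `τ₁`, `τ₂` outside `e₁ ∪ e₂` and pairs `d₁` with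
`d₂`, and `τ₁ d₁` with `τ₂ d₂`. -/
def Graph.IsStarGluing (G₁ G₂ G : Graph q) (d₁ : G₁.V × Fin q)
    (d₂ : G₂.V × Fin q) : Prop :=
  ∃ (ι₁ : G₁.V → G.V) (ι₂ : G₂.V → G.V),
    Function.Injective ι₁ ∧ Function.Injective ι₂ ∧
    (∀ v₁ v₂, ι₁ v₁ ≠ ι₂ v₂) ∧
    (∀ v : G.V, (∃ v₁, ι₁ v₁ = v) ∨ (∃ v₂, ι₂ v₂ = v)) ∧
    (∀ v, G.dis (ι₁ v) = ι₁ (G₁.dis v)) ∧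
    (∀ v, G.dis (ι₂ v) = ι₂ (G₂.dis v)) ∧
    G.ferm (dartMap ι₁ d₁) = dartMap ι₂ d₂ ∧
    G.ferm (dartMap ι₁ (G₁.ferm d₁)) = dartMap ι₂ (G₂.ferm d₂) ∧
    (∀ d, d ≠ d₁ → d ≠ G₁.ferm d₁ →
      G.ferm (dartMap ι₁ d) = dartMap ι₁ (G₁.ferm d)) ∧
    (∀ d, d ≠ d₂ → d ≠ G₂.ferm d₂ →
      G.ferm (dartMap ι₂ d) = dartMap ι₂ (G₂.ferm d))

/-- `G` is the gluing `G₁^{(e₁)} ⋆̄ G₂^{(e₂)}`: as in `IsStarGluing` but the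
fermionic pairing pairs `d₁` with `τ₂ d₂`, and `τ₁ d₁` with `d₂`. -/
def Graph.IsBarGluing (G₁ G₂ G : Graph q) (d₁ : G₁.V × Fin q)
    (d₂ : G₂.V × Fin q) : Prop :=
  ∃ (ι₁ : G₁.V → G.V) (ι₂ : G₂.V → G.V),
    Function.Injective ι₁ ∧ Function.Injective ι₂ ∧
    (∀ v₁ v₂, ι₁ v₁ ≠ ι₂ v₂) ∧
    (∀ v : G.V, (∃ v₁, ι₁ v₁ = v) ∨ (∃ v₂, ι₂ v₂ = v)) ∧
    (∀ v, G.dis (ι₁ v) = ι₁ (G₁.dis v)) ∧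
    (∀ v, G.dis (ι₂ v) = ι₂ (G₂.dis v)) ∧
    G.ferm (dartMap ι₁ d₁) = dartMap ι₂ (G₂.ferm d₂) ∧
    G.ferm (dartMap ι₁ (G₁.ferm d₁)) = dartMap ι₂ d₂ ∧
    (∀ d, d ≠ d₁ → d ≠ G₁.ferm d₁ →
      G.ferm (dartMap ι₁ d) = dartMap ι₁ (G₁.ferm d)) ∧
    (∀ d, d ≠ d₂ → d ≠ G₂.ferm d₂ →
      G.ferm (dartMap ι₂ d) = dartMap ι₂ (G₂.ferm d))

/-- `H''` is the contraction of the disorder line `{v, w}` of `H`: its vertex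
set is `V(H) ∖ {v, w}` (embedded via `ι`), its disorder pairing is the
restriction of that of `H`, and its fermionic pairing pairs `τ (v, m)` with
`τ (w, m)` for each strand `m` and agrees with `τ` on all other darts. -/
def PreGraph.IsContraction (H H'' : PreGraph q) (v w : H.V) : Prop :=
  ∃ ι : H''.V → H.V,
    Function.Injective ι ∧
    (∀ u : H.V, (∃ u'', ι u'' = u) ↔ (u ≠ v ∧ u ≠ w)) ∧
    (∀ u, ι (H''.dis u) = H.dis (ι u)) ∧
    (∀ m : Fin q, ∃ a b : H''.V × Fin q,
      dartMap ι a = H.ferm (v, m) ∧ dartMap ι b = H.ferm (w, m) ∧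
      H''.ferm a = b) ∧
    (∀ d : H''.V × Fin q,
      (∀ m : Fin q, dartMap ι d ≠ H.ferm (v, m) ∧ dartMap ι d ≠ H.ferm (w, m)) →
      dartMap ι (H''.ferm d) = H.ferm (dartMap ι d))

/-- `HL` is the closure of the side `side ⊆ V(G)` of the graph `G` cut along
the fermionic lines `e₁, e₂`: its vertex set is `{v | side v}` (embedded via
`ι`), its disorder pairing is the restriction of that of `G`, and its
fermionic pairing pairs the `side`-dart of `e₁` with the `side`-dart of `e₂`
and agrees with `τ` on all darts not in `e₁ ∪ e₂`. -/
def Graph.IsSideClose (G : Graph q) (side : G.V → Prop)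
    (e₁ e₂ : Set (G.V × Fin q)) (HL : PreGraph q) : Prop :=
  ∃ ι : HL.V → G.V,
    Function.Injective ι ∧
    (∀ v : G.V, (∃ u, ι u = v) ↔ side v) ∧
    (∀ u, ι (HL.dis u) = G.dis (ι u)) ∧
    (∃ a b : HL.V × Fin q, dartMap ι a ∈ e₁ ∧ dartMap ι b ∈ e₂ ∧
      HL.ferm a = b) ∧
    (∀ d : HL.V × Fin q, dartMap ι d ∉ e₁ ∪ e₂ →
      dartMap ι (HL.ferm d) = G.ferm (dartMap ι d))

/-! ### Faces as connected components of the dart graph -/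

/-- Two darts are joined by a fermionic line or by a strand of a disorder line. -/
def faceRel {V : Type} (τ : V × Fin q → V × Fin q) (p : V → V) (d e : V × Fin q) : Prop :=
  τ d = e ∨ (p d.1, d.2) = e

/-- The relation on darts whose equivalence classes are the faces of `H`. -/
abbrev PreGraph.faceStep (H : PreGraph q) : H.Dart → H.Dart → Prop :=
  faceRel H.ferm H.dis

theorem PreGraph.dishat_apply (H : PreGraph q) (v : H.V) (m : Fin q) :
    H.dishat (v, m) = (H.dis v, m) := rfl

theorem PreGraph.dishat_invol (H : PreGraph q) (d : H.Dart) : H.dishat (H.dishat d) = d := by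
  obtain ⟨v, m⟩ := d
  simp [dishat_apply, H.dis_invol]

theorem PreGraph.dishat_fpf (H : PreGraph q) (d : H.Dart) : H.dishat d ≠ d := by
  obtain ⟨v, m⟩ := d
  simp [dishat_apply, H.dis_fpf]

theorem PreGraph.F_eq_card_quot (H : PreGraph q) : H.F = Nat.card (Quot H.faceStep) := by
  have key : ∀ g ∈ H.faceGroup, ∀ d : H.Dart,
      Quot.mk H.faceStep (g d) = Quot.mk H.faceStep d := by
    intro g hg
    induction hg using Subgroup.closure_induction with
    | mem g hg =>
      intro d
      rcases hg with rfl | rfl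
      · exact (Quot.sound (r := H.faceStep) (Or.inl rfl)).symm
      · exact (Quot.sound (r := H.faceStep) (Or.inr rfl)).symm
    | one => intro d; rfl
    | mul a b _ _ ha hb => intro d; rw [Equiv.Perm.mul_apply, ha, hb]
    | inv a _ ha => intro d; rw [← ha (a⁻¹ d), ← Equiv.Perm.mul_apply, mul_inv_cancel, Equiv.Perm.one_apply]
  have hf : H.ferm ∈ H.faceGroup := Subgroup.subset_closure (by simp)
  have hp : H.dishat ∈ H.faceGroup := Subgroup.subset_closure (by simp)
  refine Nat.card_congr
    { toFun := Quotient.lift (Quot.mk H.faceStep) ?_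
      invFun := Quot.lift (fun d => Quotient.mk (MulAction.orbitRel H.faceGroup H.Dart) d) ?_
      left_inv := ?_
      right_inv := ?_ }
  · rintro a b ⟨⟨g, hg⟩, rfl⟩
    exact key g hg b
  · rintro a b (rfl | rfl)
    · exact (Quotient.sound ⟨⟨_, hf⟩, rfl⟩ : Quotient.mk (MulAction.orbitRel H.faceGroup H.Dart) _
        = _).symm
    · exact (Quotient.sound ⟨⟨_, hp⟩, rfl⟩ : Quotient.mk (MulAction.orbitRel H.faceGroup H.Dart) _
        = _).symm
  · rintro ⟨d⟩; rfl
  · rintro ⟨d⟩; rfl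

/-! ### Isomorphisms -/

/-- An isomorphism of SYK graphs induces a bijection of their vertices. -/
theorem Graph.exists_vertexEquiv (hq : 0 < q) {G H : Graph q}
    (φ : (G.V × Fin q) ≃ (H.V × Fin q))
    (hφ : ∀ v : G.V, ∃ v' : H.V, ∀ m : Fin q, (φ (v, m)).1 = v') :
    ∃ f : G.V ≃ H.V, ∀ d, (φ d).1 = f d.1 := by
  choose f hf using hφ
  have hcard : Fintype.card G.V = Fintype.card H.V := by
    have := Fintype.card_congr φ
    simp only [Fintype.card_prod, Fintype.card_fin] at this
    exact Nat.eq_of_mul_eq_mul_right hq this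
  have hsurj : Function.Surjective f := by
    intro w
    obtain ⟨⟨v, m⟩, h⟩ := φ.surjective (w, ⟨0, hq⟩)
    exact ⟨v, by rw [← hf v m, h]⟩
  exact ⟨Equiv.ofBijective f ((Fintype.bijective_iff_surjective_and_card f).2 ⟨hsurj, hcard⟩),
    fun d => hf d.1 d.2⟩

theorem Graph.Isomorphic.refl (G : Graph q) : G.Isomorphic G :=
  ⟨Equiv.refl _, fun _ => rfl, fun _ => rfl, fun v => ⟨v, fun _ => rfl⟩⟩

theorem Graph.Isomorphic.symm (hq : 0 < q) {G H : Graph q} (h : G.Isomorphic H) :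
    H.Isomorphic G := by
  obtain ⟨φ, h₁, h₂, h₃⟩ := h
  obtain ⟨f, hf⟩ := Graph.exists_vertexEquiv hq φ h₃
  refine ⟨φ.symm, fun d => ?_, fun d => ?_, fun v => ⟨f.symm v, fun m => ?_⟩⟩
  · rw [Equiv.symm_apply_eq, h₁, Equiv.apply_symm_apply]
  · rw [Equiv.symm_apply_eq, h₂, Equiv.apply_symm_apply]
  · rw [Equiv.eq_symm_apply, ← hf, Equiv.apply_symm_apply]

theorem Graph.Isomorphic.nV_eq (hq : 0 < q) {G H : Graph q} (h : G.Isomorphic H) :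
    G.nV = H.nV := by
  obtain ⟨φ, -, -, h₃⟩ := h
  obtain ⟨f, -⟩ := Graph.exists_vertexEquiv hq φ h₃
  exact Nat.card_congr f

theorem Graph.Isomorphic.F_eq {G H : Graph q} (h : G.Isomorphic H) : G.F = H.F := by
  obtain ⟨φ, h₁, h₂, -⟩ := h
  rw [PreGraph.F_eq_card_quot, PreGraph.F_eq_card_quot]
  refine Nat.card_congr (Quot.congr φ fun a b => ?_)
  have h : G.dishat a = b ↔ H.dishat (φ a) = φ b := by rw [← h₂, φ.apply_eq_iff_eq]
  exact or_congr (by rw [← h₁, φ.apply_eq_iff_eq]) h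

/-! ### The canonical melonic move -/

/-- The fermionic pairing produced by inserting the vertices `inr false`, `inr true` on the line
`{d, τ d}` along the strand `z`. -/
def insertFun {V : Type} [DecidableEq V] (τ : Equiv.Perm (V × Fin q)) (z : Fin q)
    (d : V × Fin q) : (V ⊕ Bool) × Fin q → (V ⊕ Bool) × Fin q
  | (Sum.inl v, m) =>
    if (v, m) = d then (Sum.inr false, z)
    else if (v, m) = τ d then (Sum.inr true, z)
    else dartMap Sum.inl (τ (v, m))
  | (Sum.inr b, k) =>
    if k = z then dartMap Sum.inl (if b then τ d else d) else (Sum.inr (!b), k)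

section insertFun

variable {V : Type} [DecidableEq V] (τ : Equiv.Perm (V × Fin q)) (z : Fin q) (d : V × Fin q)

theorem insertFun_self : insertFun τ z d (dartMap Sum.inl d) = (Sum.inr false, z) := by
  simp [insertFun, dartMap]

theorem insertFun_partner (hf : τ d ≠ d) :
    insertFun τ z d (dartMap Sum.inl (τ d)) = (Sum.inr true, z) := by
  simp [insertFun, dartMap, hf]

theorem insertFun_of_ne (e : V × Fin q) (h : e ≠ d) (h' : e ≠ τ d) :
    insertFun τ z d (dartMap Sum.inl e) = dartMap Sum.inl (τ e) := by
  simp [insertFun, dartMap, h, h']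

theorem insertFun_inr (b : Bool) :
    insertFun τ z d (Sum.inr b, z) = dartMap Sum.inl (if b then τ d else d) := by
  simp [insertFun]

theorem insertFun_inr_true : insertFun τ z d (Sum.inr true, z) = dartMap Sum.inl (τ d) := by
  simp [insertFun]

theorem insertFun_inr_of_ne (b : Bool) (k : Fin q) (h : k ≠ z) :
    insertFun τ z d (Sum.inr b, k) = (Sum.inr (!b), k) := by
  simp [insertFun, h]

theorem insertFun_invol (hi : ∀ e, τ (τ e) = e) (hf : ∀ e, τ e ≠ e) :
    Function.Involutive (insertFun τ z d) := by
  rintro ⟨v | b, m⟩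
  · change insertFun τ z d (insertFun τ z d (dartMap Sum.inl (v, m))) = dartMap Sum.inl (v, m)
    by_cases h : (v, m) = d
    · rw [h, insertFun_self, insertFun_inr]; simp
    by_cases h' : (v, m) = τ d
    · rw [h', insertFun_partner τ z d (hf d), insertFun_inr]; simp
    rw [insertFun_of_ne τ z d _ h h', insertFun_of_ne, hi]
    · rintro h₁; exact h' (by rw [← h₁, hi])
    · exact fun h₁ => h (τ.injective h₁)
  · by_cases h : m = z
    · subst h
      rw [insertFun_inr]
      cases b
      · simp [insertFun_self]
      · simp [insertFun_partner τ m d (hf d)]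
    · rw [insertFun_inr_of_ne _ _ _ _ _ h, insertFun_inr_of_ne _ _ _ _ _ h, Bool.not_not]

theorem insertFun_fpf (hf : ∀ e, τ e ≠ e) (e : (V ⊕ Bool) × Fin q) : insertFun τ z d e ≠ e := by
  obtain ⟨v | b, m⟩ := e
  · change insertFun τ z d (dartMap Sum.inl (v, m)) ≠ dartMap Sum.inl (v, m)
    by_cases h : (v, m) = d
    · rw [h, insertFun_self]; simp [dartMap]
    by_cases h' : (v, m) = τ d
    · rw [h', insertFun_partner τ z d (hf d)]; simp [dartMap]
    rw [insertFun_of_ne τ z d _ h h']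
    have := hf (v, m)
    contrapose! this
    simpa [dartMap, Prod.ext_iff] using this
  · by_cases h : m = z
    · subst h
      rw [insertFun_inr]; simp [dartMap]
    · rw [insertFun_inr_of_ne _ _ _ _ _ h]; simp

/-- The face containing a dart after the insertion of a melon on the line of `d`. -/
def insertFace (p : V → V) : (V ⊕ Bool) × Fin q → Quot (faceRel τ p) ⊕ {k : Fin q // k ≠ z}
  | (Sum.inl v, m) => Sum.inl (Quot.mk _ (v, m))
  | (Sum.inr _, k) => if h : k = z then Sum.inl (Quot.mk _ d) else Sum.inr ⟨k, h⟩

theorem card_quot_insertFun [Finite V] (p : V → V) (hi : ∀ e, τ (τ e) = e) (hf : ∀ e, τ e ≠ e) :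
    Nat.card (Quot (faceRel (insertFun τ z d) (Sum.map p not))) =
      Nat.card (Quot (faceRel τ p)) + (q - 1) := by
  set R := faceRel (insertFun τ z d) (Sum.map p not)
  have hfd : Quot.mk (faceRel τ p) d = Quot.mk _ (τ d) := Quot.sound (Or.inl rfl)
  have hs : ∀ e, Quot.mk R e = Quot.mk R (insertFun τ z d e) := fun e => Quot.sound (Or.inl rfl)
  have hp : ∀ e, Quot.mk R e = Quot.mk R (Sum.map p not e.1, e.2) :=
    fun e => Quot.sound (Or.inr rfl)
  have hy : ∀ k, Quot.mk R (Sum.inr true, k) = Quot.mk R (Sum.inr false, k) := fun k => hp _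
  have hdx : Quot.mk R (dartMap Sum.inl d) = Quot.mk R (Sum.inr false, z) := by
    rw [hs, insertFun_self]
  have hdy : Quot.mk R (dartMap Sum.inl (τ d)) = Quot.mk R (Sum.inr true, z) := by
    rw [hs, insertFun_partner _ _ _ (hf d)]
  have e : Quot R ≃ Quot (faceRel τ p) ⊕ {k : Fin q // k ≠ z} :=
    { toFun := Quot.lift (insertFace τ z d p) (by
        rintro ⟨v | b, m⟩ e' (rfl | rfl)
        · change _ = insertFace τ z d p (insertFun τ z d (dartMap Sum.inl (v, m)))
          by_cases h : (v, m) = d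
          · rw [h, insertFun_self]; simp [insertFace, h]
          by_cases h' : (v, m) = τ d
          · rw [h', insertFun_partner _ _ _ (hf d)]; simp [insertFace, h', hfd]
          rw [insertFun_of_ne _ _ _ _ h h']
          exact congrArg Sum.inl (Quot.sound (Or.inl rfl))
        · exact congrArg Sum.inl (Quot.sound (Or.inr rfl))
        · by_cases h : m = z
          · rw [h, insertFun_inr]
            cases b
            · simp [insertFace, dartMap]
            · simp [insertFace, dartMap, hfd]
          · rw [insertFun_inr_of_ne _ _ _ _ _ h]; simp [insertFace]
        · rfl)
      invFun := Sum.elim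
        (Quot.lift (fun e => Quot.mk R (dartMap Sum.inl e)) (by
          rintro e e' (rfl | rfl)
          · by_cases h : e = d
            · simp only [h, hdx, hdy, hy]
            by_cases h' : e = τ d
            · simp only [h', hi, hdx, hdy, hy]
            · rw [hs, insertFun_of_ne _ _ _ _ h h']
          · exact hp _))
        (fun k => Quot.mk _ (Sum.inr false, k.1))
      left_inv := by
        rintro ⟨⟨v | b, m⟩⟩
        · rfl
        · by_cases h : m = z
          · have : insertFace τ z d p (Sum.inr b, m) = Sum.inl (Quot.mk _ d) := by
              simp [insertFace, h]
            refine (congrArg _ this).trans ?_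
            change Quot.mk R (dartMap Sum.inl d) = Quot.mk _ (Sum.inr b, m)
            rw [hdx, h]
            cases b
            · rfl
            · exact (hy z).symm
          · have : insertFace τ z d p (Sum.inr b, m) = Sum.inr ⟨m, h⟩ := by
              simp [insertFace, h]
            refine (congrArg _ this).trans ?_
            change Quot.mk R (Sum.inr false, m) = Quot.mk _ (Sum.inr b, m)
            cases b
            · rfl
            · exact (hy m).symm
      right_inv := by
        rintro (⟨⟨v, m⟩⟩ | ⟨k, hk⟩)
        · rfl
        · change insertFace τ z d p (Sum.inr false, k) = _
          simp [insertFace, hk] }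
  rw [Nat.card_congr e, Nat.card_sum]
  simp

end insertFun

/-- The graph obtained from `H` by inserting a melon on the line of `d`, before knowing that it is
connected. -/
def PreGraph.insertMelon (H : PreGraph q) (d : H.Dart) : PreGraph q where
  V := H.V ⊕ Bool
  ferm := (insertFun_invol H.ferm ⟨0, d.2.pos⟩ d H.ferm_invol H.ferm_fpf).toPerm
  dis := Equiv.sumCongr H.dis Equiv.boolNot
  ferm_invol := insertFun_invol H.ferm ⟨0, d.2.pos⟩ d H.ferm_invol H.ferm_fpf
  ferm_fpf := insertFun_fpf H.ferm ⟨0, d.2.pos⟩ d H.ferm_fpf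
  dis_invol := by rintro (v | b) <;> simp [H.dis_invol]
  dis_fpf := by rintro (v | b) <;> simp [H.dis_fpf]

theorem PreGraph.adj0_iff (H : PreGraph q) (v w : H.V) :
    H.adj0 v w ↔ ∃ m m', H.ferm (v, m) = (w, m') := by
  simp [adj0, adj0Off]

theorem PreGraph.adj0_symm (H : PreGraph q) : Std.Symm H.adj0 := by
  refine ⟨fun v w h => ?_⟩
  rw [adj0_iff] at h ⊢
  obtain ⟨m, m', h⟩ := h
  exact ⟨m', m, by rw [← h, H.ferm_invol]⟩

theorem PreGraph.conn0_insertMelon (hq : 2 ≤ q) (H : PreGraph q) (d : H.Dart) (hc : H.Conn0) :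
    (H.insertMelon d).Conn0 := by
  let M := H.insertMelon d
  have hsymm : ∀ a b, Relation.ReflTransGen M.adj0 a b → Relation.ReflTransGen M.adj0 b a :=
    fun a b h => by
      have := M.adj0_symm
      exact Std.Symm.symm _ _ h
  have hone : ∀ e e' : M.Dart, M.ferm e = e' → Relation.ReflTransGen M.adj0 e.1 e'.1 :=
    fun e e' h => .single ((M.adj0_iff _ _).2 ⟨e.2, e'.2, h⟩)
  have hx : Relation.ReflTransGen M.adj0 (Sum.inl d.1) (Sum.inr false) :=
    hone (Sum.inl d.1, d.2) (Sum.inr false, _) (insertFun_self H.ferm ⟨0, d.2.pos⟩ d)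
  have hy : Relation.ReflTransGen M.adj0 (Sum.inl (H.ferm d).1) (Sum.inr true) :=
    hone (Sum.inl _, _) (Sum.inr true, _) (insertFun_partner H.ferm ⟨0, d.2.pos⟩ d (H.ferm_fpf d))
  have hxy : Relation.ReflTransGen M.adj0 (Sum.inr false) (Sum.inr true) :=
    hone (Sum.inr false, ⟨1, hq⟩) (Sum.inr true, ⟨1, hq⟩)
      (insertFun_inr_of_ne H.ferm ⟨0, d.2.pos⟩ d false ⟨1, hq⟩ (by simp))
  have hold : ∀ v w, Relation.ReflTransGen H.adj0 v w →
      Relation.ReflTransGen M.adj0 (Sum.inl v) (Sum.inl w) := by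
    intro v w h
    induction h with
    | refl => exact .refl
    | @tail b c _ hbc ih =>
      refine ih.trans ?_
      rw [H.adj0_iff] at hbc
      obtain ⟨m, m', h⟩ := hbc
      by_cases h₁ : (b, m) = d
      · subst h₁
        rw [h] at hy
        exact hx.trans (hxy.trans (hsymm _ _ hy))
      by_cases h₂ : (b, m) = H.ferm d
      · rw [h₂, H.ferm_invol] at h
        rw [← h₂] at hy
        rw [h] at hx
        exact hy.trans ((hsymm _ _ hxy).trans (hsymm _ _ hx))
      · refine hone (Sum.inl b, m) (Sum.inl c, m') ?_
        exact (insertFun_of_ne H.ferm ⟨0, d.2.pos⟩ d (b, m) h₁ h₂).trans (by rw [h]; rfl)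
  have hall : ∀ a, Relation.ReflTransGen M.adj0 (Sum.inl d.1) a := by
    rintro (v | b)
    · exact hold _ _ (hc _ _)
    · cases b
      · exact hx
      · exact hx.trans hxy
  exact fun a b => (hsymm _ _ (hall a)).trans (hall b)

/-- The melonic move on the line of `d`, performed on a disjoint union. -/
def Graph.insertMelon (hq : 2 ≤ q) (G : Graph q) (d : G.V × Fin q) : Graph q where
  toPreGraph := G.toPreGraph.insertMelon d
  conn := G.toPreGraph.conn0_insertMelon hq d G.conn

theorem Graph.melonicMove_insertMelon (hq : 2 ≤ q) (G : Graph q) (d : G.V × Fin q) :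
    G.MelonicMove (G.insertMelon hq d) := by
  refine ⟨Sum.inr false, Sum.inr true, Sum.inl, d, Sum.inl_injective, Sum.inr_injective.ne (by simp), ?_, rfl,
    fun _ => rfl, insertFun_self _ _ _, insertFun_inr_true G.ferm ⟨0, d.2.pos⟩ d,
    fun k hk => insertFun_inr_of_ne _ _ _ _ _ hk, fun e h h' => insertFun_of_ne _ _ _ _ h h'⟩
  have : ∀ v' : G.V ⊕ Bool, (¬ ∃ v, Sum.inl v = v') ↔ (v' = Sum.inr false ∨ v' = Sum.inr true) := by
    rintro (v | b) <;> simp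
  exact this

theorem Graph.nV_insertMelon (hq : 2 ≤ q) (G : Graph q) (d : G.V × Fin q) :
    (G.insertMelon hq d).nV = G.nV + 2 := by
  change Nat.card (G.V ⊕ Bool) = _
  rw [Nat.card_sum]
  simp [PreGraph.nV]

theorem Graph.F_insertMelon (hq : 2 ≤ q) (G : Graph q) (d : G.V × Fin q) :
    (G.insertMelon hq d).F = G.F + (q - 1) := by
  rw [PreGraph.F_eq_card_quot, PreGraph.F_eq_card_quot]
  have hdis : ∀ v : G.V ⊕ Bool, (G.insertMelon hq d).dis v = Sum.map G.dis not v := by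
    rintro (v | b) <;> rfl
  have hrel : (G.insertMelon hq d).faceStep =
      faceRel (insertFun G.ferm ⟨0, d.2.pos⟩ d) (Sum.map G.dis not) := by
    ext e e'
    exact or_congr Iff.rfl (Iff.of_eq (congrArg (fun v => (v, e.2) = e') (hdis e.1)))
  rw [hrel]
  exact card_quot_insertFun G.ferm _ d G.dis G.ferm_invol G.ferm_fpf

/-! ### Melonic insertions along an arbitrary strand -/

/-- `G'` arises from `G` by inserting the vertices `x`, `y` on the line of `d` along strand `j`. -/
structure Graph.IsInsertion (G G' : Graph q) (x y : G'.V) (ι : G.V → G'.V) (d : G.V × Fin q)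
    (j : Fin q) : Prop where
  inj : Function.Injective ι
  ne : x ≠ y
  range : ∀ v' : G'.V, (¬ ∃ v, ι v = v') ↔ (v' = x ∨ v' = y)
  dis_new : G'.dis x = y
  dis_old : ∀ v, G'.dis (ι v) = ι (G.dis v)
  ferm_left : G'.ferm (dartMap ι d) = (x, j)
  ferm_right : G'.ferm (y, j) = dartMap ι (G.ferm d)
  ferm_new : ∀ k : Fin q, k ≠ j → G'.ferm (x, k) = (y, k)
  ferm_old : ∀ d' : G.V × Fin q, d' ≠ d → d' ≠ G.ferm d →
    G'.ferm (dartMap ι d') = dartMap ι (G.ferm d')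

theorem dartMap_injective {α β : Type} {ι : α → β} (h : Function.Injective ι) :
    Function.Injective (dartMap (q := q) ι) := by
  rintro ⟨a, m⟩ ⟨b, n⟩ hab
  simp only [dartMap, Prod.mk.injEq] at hab
  rw [h hab.1, hab.2]

/-- Insertions at corresponding lines of isomorphic graphs are isomorphic, whatever the strand. -/
theorem Graph.IsInsertion.isomorphic (hq : 2 ≤ q) {G G' H : Graph q} {x y : G'.V}
    {ι : G.V → G'.V} {d : G.V × Fin q} {j : Fin q} (h : G.IsInsertion G' x y ι d j)
    (φ : (G.V × Fin q) ≃ (H.V × Fin q)) (h₁ : ∀ e, φ (G.ferm e) = H.ferm (φ e))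
    (h₂ : ∀ e, φ (G.dishat e) = H.dishat (φ e))
    (h₃ : ∀ v : G.V, ∃ v' : H.V, ∀ m : Fin q, (φ (v, m)).1 = v') :
    G'.Isomorphic (H.insertMelon hq (φ d)) := by
  obtain ⟨f, hf⟩ := Graph.exists_vertexEquiv (by omega) φ h₃
  set z : Fin q := ⟨0, (φ d).2.pos⟩
  have hxr : ∀ v, ι v ≠ x := fun v hv => (h.range x).2 (Or.inl rfl) ⟨v, hv⟩
  have hyr : ∀ v, ι v ≠ y := fun v hv => (h.range y).2 (Or.inr rfl) ⟨v, hv⟩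
  let ψ : (H.V ⊕ Bool) × Fin q → G'.V × Fin q
    | (Sum.inl v, m) => dartMap ι (φ.symm (v, m))
    | (Sum.inr b, k) => (if b then y else x, Equiv.swap z j k)
  have hψl : ∀ e, ψ (dartMap Sum.inl e) = dartMap ι (φ.symm e) := fun _ => rfl
  have hψx : ∀ k, ψ (Sum.inr false, k) = (x, Equiv.swap z j k) := fun _ => rfl
  have hψy : ∀ k, ψ (Sum.inr true, k) = (y, Equiv.swap z j k) := fun _ => rfl
  have hinj : Function.Injective ψ := by
    rintro ⟨v | b, m⟩ ⟨v' | b', m'⟩ he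
    · have := φ.symm.injective (dartMap_injective h.inj he)
      simpa [Prod.ext_iff] using this
    · cases b'
      · exact absurd (congrArg Prod.fst he) (hxr _)
      · exact absurd (congrArg Prod.fst he) (hyr _)
    · cases b
      · exact absurd (congrArg Prod.fst he).symm (hxr _)
      · exact absurd (congrArg Prod.fst he).symm (hyr _)
    · have hm : m = m' := (Equiv.swap z j).injective (congrArg Prod.snd he)
      have hb := congrArg Prod.fst he
      cases b <;> cases b' <;> simp_all [ψ, h.ne, h.ne.symm]
  have hsurj : Function.Surjective ψ := by
    rintro ⟨u, k⟩
    by_cases hu : ∃ v, ι v = u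
    · obtain ⟨v, rfl⟩ := hu
      exact ⟨dartMap Sum.inl (φ (v, k)), by rw [hψl, Equiv.symm_apply_apply]; rfl⟩
    · rcases (h.range u).1 hu with rfl | rfl
      · exact ⟨(Sum.inr false, Equiv.swap z j k), by rw [hψx, Equiv.swap_apply_self]⟩
      · exact ⟨(Sum.inr true, Equiv.swap z j k), by rw [hψy, Equiv.swap_apply_self]⟩
  have hferm : ∀ e, ψ (insertFun H.ferm z (φ d) e) = G'.ferm (ψ e) := by
    rintro ⟨v | b, m⟩
    · change ψ (insertFun H.ferm z (φ d) (dartMap Sum.inl (v, m))) =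
        G'.ferm (ψ (dartMap Sum.inl (v, m)))
      obtain ⟨e, he⟩ := φ.surjective (v, m)
      rw [← he]
      by_cases hd : e = d
      · rw [hd, insertFun_self, hψx, hψl, Equiv.symm_apply_apply, h.ferm_left,
          Equiv.swap_apply_left]
      by_cases hd' : e = G.ferm d
      · rw [hd', h₁, insertFun_partner _ _ _ (H.ferm_fpf _), hψy, hψl, ← h₁,
          Equiv.symm_apply_apply, ← h.ferm_right, G'.ferm_invol, Equiv.swap_apply_left]
      · rw [insertFun_of_ne _ _ _ _ (fun hh => hd (φ.injective hh))
          (fun hh => hd' (φ.injective (hh.trans (h₁ d).symm))), hψl, hψl, ← h₁,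
          Equiv.symm_apply_apply, Equiv.symm_apply_apply, h.ferm_old e hd hd']
    · by_cases hm : m = z
      · rw [hm, insertFun_inr, hψl]
        cases b
        · rw [hψx, Equiv.swap_apply_left, ← h.ferm_left, G'.ferm_invol]; simp
        · rw [hψy, Equiv.swap_apply_left, h.ferm_right]; simp [← h₁]
      · have hj : Equiv.swap z j m ≠ j := fun hh => hm
          ((Equiv.swap z j).injective (hh.trans (Equiv.swap_apply_left z j).symm))
        rw [insertFun_inr_of_ne _ _ _ _ _ hm]
        cases b
        · rw [hψx, h.ferm_new _ hj]; rfl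
        · rw [hψy, ← h.ferm_new _ hj, G'.ferm_invol]; rfl
  have hdis : ∀ e : (H.V ⊕ Bool) × Fin q,
      ψ (Sum.map H.dis not e.1, e.2) = G'.dishat (ψ e) := by
    rintro ⟨v | b, m⟩
    · change dartMap ι (φ.symm (H.dishat (v, m))) = G'.dishat (dartMap ι (φ.symm (v, m)))
      obtain ⟨e, he⟩ := φ.surjective (v, m)
      rw [← he, ← h₂, Equiv.symm_apply_apply, Equiv.symm_apply_apply]
      exact Prod.ext (h.dis_old e.1).symm rfl
    · cases b
      · exact Prod.ext h.dis_new.symm rfl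
      · refine Prod.ext ?_ rfl
        change x = G'.dis y
        rw [← h.dis_new, G'.dis_invol]
  refine Graph.Isomorphic.symm (by omega)
    ⟨Equiv.ofBijective ψ ⟨hinj, hsurj⟩, hferm, fun e => ?_, ?_⟩
  · refine (congrArg ψ ?_).trans (hdis e)
    obtain ⟨v | b, m⟩ := e <;> rfl
  · have : ∀ v : H.V ⊕ Bool, ∃ v', ∀ m, (ψ (v, m)).1 = v' := by
      rintro (v | b)
      · refine ⟨ι (f.symm v), fun m => congrArg ι ?_⟩
        rw [Equiv.eq_symm_apply, ← hf, Equiv.apply_symm_apply]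
      · exact ⟨_, fun m => rfl⟩
    exact this

theorem Graph.MelonicMove.isomorphic (hq : 2 ≤ q) {G G' : Graph q} (h : G.MelonicMove G') :
    ∃ d, G'.Isomorphic (G.insertMelon hq d) := by
  obtain ⟨x, y, ι, d, h₁, h₂, h₃, h₄, h₅, h₆, h₇, h₈, h₉⟩ := h
  exact ⟨d, (IsInsertion.mk (j := ⟨0, d.2.pos⟩) h₁ h₂ h₃ h₄ h₅ h₆ h₇ h₈ h₉).isomorphic hq
    (Equiv.refl _) (fun _ => rfl) (fun _ => rfl) fun v => ⟨v, fun _ => rfl⟩⟩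

theorem Graph.IsMelonic.of_insertion (hq : 2 ≤ q) {G G' : Graph q} {x y : G'.V}
    {ι : G.V → G'.V} {d : G.V × Fin q} {j : Fin q} (h : G.IsInsertion G' x y ι d j)
    (hG : G.IsMelonic) : G'.IsMelonic := by
  obtain ⟨G₀, Gn, hmin, hmoves, φ, h₁, h₂, h₃⟩ := hG
  exact ⟨G₀, _, hmin, hmoves.tail (Gn.melonicMove_insertMelon hq (φ d)),
    h.isomorphic hq φ h₁ h₂ h₃⟩

/-! ### The number of faces of melonic graphs -/

theorem Graph.IsMin.nV_eq {G : Graph q} (h : G.IsMin) : G.nV = 2 := by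
  obtain ⟨a, b, hab, hall, -, -⟩ := h
  have : (Finset.univ : Finset G.V) = {a, b} := by
    ext v; simpa using hall v
  rw [PreGraph.nV, Nat.card_eq_fintype_card, ← Finset.card_univ, this, Finset.card_pair hab]

theorem Graph.IsMin.F_eq {G : Graph q} (h : G.IsMin) : G.F = q := by
  obtain ⟨a, b, hab, hall, hdis, hferm⟩ := h
  have hferm' : ∀ m, G.ferm (b, m) = (a, m) := fun m => by rw [← hferm, G.ferm_invol]
  rw [PreGraph.F_eq_card_quot]
  have e : Quot G.faceStep ≃ Fin q :=
    { toFun := Quot.lift Prod.snd (by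
        rintro ⟨v, m⟩ e' (rfl | rfl)
        · rcases hall v with rfl | rfl
          · rw [hferm]
          · rw [hferm']
        · rfl)
      invFun := fun m => Quot.mk _ (a, m)
      left_inv := by
        rintro ⟨⟨v, m⟩⟩
        rcases hall v with rfl | rfl
        · rfl
        · exact Quot.sound (Or.inl (hferm m))
      right_inv := fun m => rfl }
  rw [Nat.card_congr e, Nat.card_fin]

theorem Graph.IsMelonic.two_mul_F (hq : 2 ≤ q) {G : Graph q} (h : G.IsMelonic) :
    2 * G.F = (q - 1) * G.nV + 2 := by
  obtain ⟨G₀, Gn, hmin, hmoves, hiso⟩ := h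
  rw [hiso.F_eq, hiso.nV_eq (by omega)]
  clear hiso
  induction hmoves with
  | refl => rw [hmin.F_eq, hmin.nV_eq]; omega
  | tail _ hmove ih =>
    obtain ⟨d, hd⟩ := hmove.isomorphic hq
    rw [hd.F_eq, hd.nV_eq (by omega), F_insertMelon, nV_insertMelon, mul_add, ih, mul_add]
    ring

/-- The minimal graph on the vertices `false` and `true`. -/
def minGraph (hq : 0 < q) : Graph q where
  V := Bool
  ferm := Equiv.prodCongr Equiv.boolNot (Equiv.refl _)
  dis := Equiv.boolNot
  ferm_invol := by rintro ⟨b, m⟩; simp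
  ferm_fpf := by rintro ⟨b, m⟩; simp
  dis_invol := by simp
  dis_fpf := by simp
  conn := by
    have hz : ∀ b c : Bool, c = !b → ∃ m m' : Fin q, (b, m) ∉ (∅ : Set (Bool × Fin q)) ∧
        Equiv.prodCongr Equiv.boolNot (Equiv.refl (Fin q)) (b, m) = (c, m') :=
      fun b c h => ⟨⟨0, hq⟩, ⟨0, hq⟩, by simp, by simp [h]⟩
    intro b c
    by_cases h : b = c
    · rw [h]
    · exact .single (hz b c (by cases b <;> cases c <;> simp_all))

theorem minGraph_isMin (hq : 0 < q) : (minGraph hq).IsMin :=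
  ⟨false, true, Bool.false_ne_true, fun v => by
    rcases v with _ | _
    · exact Or.inl rfl
    · exact Or.inr rfl, rfl, fun _ => rfl⟩

theorem exists_isMelonic_nV (hq : 2 ≤ q) (k : ℕ) :
    ∃ G : Graph q, G.IsMelonic ∧ G.nV = 2 * (k + 1) := by
  suffices ∃ G : Graph q, Relation.ReflTransGen Graph.MelonicMove (minGraph (by omega)) G ∧
      G.nV = 2 * (k + 1) by
    obtain ⟨G, h, hn⟩ := this
    exact ⟨G, ⟨_, G, minGraph_isMin _, h, Graph.Isomorphic.refl G⟩, hn⟩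
  induction k with
  | zero => exact ⟨_, .refl, (minGraph_isMin _).nV_eq⟩
  | succ k ih =>
    obtain ⟨G, h, hn⟩ := ih
    have d : G.V × Fin q := (Classical.arbitrary G.V, ⟨0, by omega⟩)
    exact ⟨_, h.tail (G.melonicMove_insertMelon hq d), by rw [Graph.nV_insertMelon, hn]; ring⟩

theorem PreGraph.even_nV (H : PreGraph q) : Even H.nV := by
  have hsq : H.dis ^ 2 = 1 := by
    ext v; simp [pow_two, H.dis_invol]
  have hsupp : H.dis.support = Finset.univ := by
    ext v; simp [H.dis_fpf]
  have := Equiv.Perm.two_dvd_card_support hsq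
  rw [hsupp, Finset.card_univ] at this
  rw [nV, Nat.card_eq_fintype_card]
  exact even_iff_two_dvd.2 this

theorem PreGraph.nV_pos (H : PreGraph q) : 0 < H.nV := Nat.card_pos

/-! ### Dipoles -/

/-- Faces of length one consist of two darts, on which the two pairings agree; every other face
has at least four darts. -/
theorem PreGraph.four_mul_F_le (H : PreGraph q) :
    4 * H.F ≤ H.nV * q + (Finset.univ.filter fun d => H.ferm d = H.dishat d).card := by
  classical
  have : Fintype (Quot H.faceStep) := Fintype.ofFinite _
  rw [F_eq_card_quot, Nat.card_eq_fintype_card, nV, Nat.card_eq_fintype_card]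
  set s := Finset.univ.filter fun d => H.ferm d = H.dishat d with hs
  have hferm : ∀ d, Quot.mk H.faceStep (H.ferm d) = Quot.mk _ d :=
    fun d => (Quot.sound (r := H.faceStep) (Or.inl rfl)).symm
  have hdis : ∀ d, Quot.mk H.faceStep (H.dishat d) = Quot.mk _ d :=
    fun d => (Quot.sound (r := H.faceStep) (Or.inr rfl)).symm
  have htotal : Fintype.card H.V * q + s.card = ∑ d : H.Dart, (1 + if d ∈ s then 1 else 0) := by
    rw [Finset.sum_add_distrib]
    simp
  have hfib : ∀ c : Quot H.faceStep, 4 ≤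
      ∑ d ∈ Finset.univ.filter (fun d => Quot.mk H.faceStep d = c),
        (1 + if d ∈ s then 1 else 0) := by
    rintro ⟨d⟩
    by_cases hd : d ∈ s
    · have hd' : H.ferm d = H.dishat d := by simpa [hs] using hd
      have hτ : H.ferm d ∈ s := by
        simp only [hs, Finset.mem_filter, Finset.mem_univ, true_and]
        rw [H.ferm_invol, hd', H.dishat_invol]
      calc 4 = ∑ e ∈ {d, H.ferm d}, (1 + if e ∈ s then 1 else 0) := by
            rw [Finset.sum_pair (H.ferm_fpf d).symm, if_pos hd, if_pos hτ]
        _ ≤ _ := by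
            refine Finset.sum_le_sum_of_subset fun e he => ?_
            simp only [Finset.mem_insert, Finset.mem_singleton] at he
            rcases he with rfl | rfl <;> simp [hferm]
    · have hd' : H.ferm d ≠ H.dishat d := by simpa [hs] using hd
      have h₁ := H.ferm_fpf d
      have h₂ := H.dishat_fpf d
      have h₃ : H.ferm (H.dishat d) ≠ d := fun h => hd' (by
        conv_lhs => rw [← h]
        rw [H.ferm_invol])
      have h₄ : H.ferm (H.dishat d) ≠ H.ferm d := fun h => h₂ (H.ferm.injective h)
      have h₅ : H.ferm (H.dishat d) ≠ H.dishat d := H.ferm_fpf _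
      have hcard : ({d, H.ferm d, H.dishat d, H.ferm (H.dishat d)} : Finset H.Dart).card = 4 := by
        rw [Finset.card_insert_of_notMem, Finset.card_insert_of_notMem, Finset.card_pair h₅.symm]
        · simp [hd', h₄.symm]
        · simp [h₁.symm, h₂.symm, h₃.symm]
      calc 4 = ∑ e ∈ ({d, H.ferm d, H.dishat d, H.ferm (H.dishat d)} : Finset H.Dart), 1 := by
            rw [← Finset.card_eq_sum_ones, hcard]
        _ ≤ ∑ e ∈ ({d, H.ferm d, H.dishat d, H.ferm (H.dishat d)} : Finset H.Dart),
              (1 + if e ∈ s then 1 else 0) := Finset.sum_le_sum fun _ _ => Nat.le_add_right _ _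
        _ ≤ _ := by
            refine Finset.sum_le_sum_of_subset fun e he => ?_
            simp only [Finset.mem_insert, Finset.mem_singleton] at he
            rcases he with rfl | rfl | rfl | rfl <;> simp [hferm, hdis]
  rw [htotal, ← Finset.sum_fiberwise Finset.univ (Quot.mk H.faceStep)]
  calc 4 * Fintype.card (Quot H.faceStep) = ∑ _c : Quot H.faceStep, 4 := by simp [mul_comm]
    _ ≤ _ := Finset.sum_le_sum fun c _ => hfib c

/-- A graph with many faces has a disorder line with at least `q - 1` faces of length one. -/
theorem PreGraph.exists_dipole (hq : 2 ≤ q) (H : PreGraph q)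
    (h : (q - 1) * H.nV + 2 ≤ 2 * H.F) :
    ∃ v, (Finset.univ.filter fun m => H.ferm (v, m) ≠ (H.dis v, m)).card ≤ 1 := by
  by_contra! hlt
  have hcard : (Finset.univ.filter fun d => H.ferm d = H.dishat d).card =
      ∑ v, (Finset.univ.filter fun m => H.ferm (v, m) = (H.dis v, m)).card := by
    simp only [Finset.card_filter]
    exact Fintype.sum_prod_type _
  have hle : ∑ v, (Finset.univ.filter fun m => H.ferm (v, m) = (H.dis v, m)).card ≤
      ∑ _v : H.V, (q - 2) := by
    refine Finset.sum_le_sum fun v _ => ?_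
    have h₁ := hlt v
    have h₂ := Finset.card_filter_add_card_filter_not (s := Finset.univ)
      (fun m => H.ferm (v, m) = (H.dis v, m))
    rw [Finset.card_univ, Fintype.card_fin] at h₂
    simp only [ne_eq] at h₁
    omega
  have h4 := H.four_mul_F_le
  rw [hcard] at h4
  rw [Finset.sum_const, Finset.card_univ, ← Nat.card_eq_fintype_card, ← nV, smul_eq_mul] at hle
  obtain ⟨r, rfl⟩ := Nat.exists_eq_add_of_le hq
  simp only [Nat.add_sub_cancel_left, show 2 + r - 1 = r + 1 by omega] at *
  nlinarith

theorem Graph.isMin_of_ferm_eq (G : Graph q) (v : G.V)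
    (h : ∀ m, G.ferm (v, m) = (G.dis v, m)) : G.IsMin := by
  refine ⟨v, G.dis v, (G.dis_fpf v).symm, fun u => ?_, rfl, h⟩
  have hu := G.conn v u
  induction hu with
  | refl => exact Or.inl rfl
  | tail _ hstep ih =>
    rw [PreGraph.adj0_iff] at hstep
    obtain ⟨m, m', hm⟩ := hstep
    rcases ih with rfl | rfl
    · rw [h] at hm
      exact Or.inr (congrArg Prod.fst hm).symm
    · rw [← h, G.ferm_invol] at hm
      exact Or.inl (congrArg Prod.fst hm).symm

section contraction

variable {V : Type} (τ : Equiv.Perm (V × Fin q)) (v w : V) (j : Fin q)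

/-- The vertices `v ≠ w` are joined along all strands other than `j`, but not along `j`. -/
structure IsDipole : Prop where
  ne : v ≠ w
  invol : ∀ e, τ (τ e) = e
  fpf : ∀ e, τ e ≠ e
  ferm_eq : ∀ m, m ≠ j → τ (v, m) = (w, m)
  ferm_ne : τ (v, j) ≠ (w, j)

variable {τ v w j}

theorem IsDipole.symm (h : IsDipole τ v w j) : IsDipole τ w v j where
  ne := h.ne.symm
  invol := h.invol
  fpf := h.fpf
  ferm_eq m hm := by rw [← h.ferm_eq m hm, h.invol]
  ferm_ne hj := h.ferm_ne (by rw [← hj, h.invol])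

theorem IsDipole.eq_of_fst_eq (h : IsDipole τ v w j) {e : V × Fin q} (he : e.1 = v)
    (hτ : (τ e).1 ≠ w) : e = (v, j) := by
  obtain ⟨u, m⟩ := e
  obtain rfl : u = v := he
  by_cases hm : m = j
  · rw [hm]
  · exact absurd (congrArg Prod.fst (h.ferm_eq m hm)) hτ

theorem IsDipole.fst_ne (h : IsDipole τ v w j) : (τ (v, j)).1 ≠ v ∧ (τ (v, j)).1 ≠ w := by
  have hv : (τ (v, j)).1 ≠ v := fun hv => by
    have := h.eq_of_fst_eq hv (by rw [h.invol]; exact h.ne)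
    exact h.fpf _ this
  refine ⟨hv, fun hw => ?_⟩
  rcases hu : τ (v, j) with ⟨u, m⟩
  rw [hu] at hw
  obtain rfl : u = w := hw
  have hm : m = j := by
    by_contra hm
    have := h.ferm_eq m hm
    rw [← hu] at this
    exact hm (congrArg Prod.snd (τ.injective this))
  exact h.ferm_ne (by rw [hu, hm])

variable [DecidableEq V]

/-- The fermionic pairing after the removal of `v` and `w`, which are joined along all strands
other than `j`. -/
def removeFun (τ : Equiv.Perm (V × Fin q)) (v w : V) (j : Fin q) (e : V × Fin q) : V × Fin q :=
  if τ e = (v, j) then τ (w, j) else if τ e = (w, j) then τ (v, j) else τ e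

theorem IsDipole.removeFun_fst (h : IsDipole τ v w j) {e : V × Fin q} (hv : e.1 ≠ v)
    (hw : e.1 ≠ w) : (removeFun τ v w j e).1 ≠ v ∧ (removeFun τ v w j e).1 ≠ w := by
  unfold removeFun
  split_ifs with h₁ h₂
  · exact h.symm.fst_ne.symm
  · exact h.fst_ne
  · exact ⟨fun hh => h₁ (h.eq_of_fst_eq hh (by rwa [h.invol])),
      fun hh => h₂ (h.symm.eq_of_fst_eq hh (by rwa [h.invol]))⟩

theorem IsDipole.removeFun_left (h : IsDipole τ v w j) :
    removeFun τ v w j (τ (v, j)) = τ (w, j) := by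
  simp [removeFun, h.invol]

theorem IsDipole.removeFun_right (h : IsDipole τ v w j) :
    removeFun τ v w j (τ (w, j)) = τ (v, j) := by
  simp [removeFun, h.invol, h.ne.symm]

theorem IsDipole.removeFun_of_ne (h : IsDipole τ v w j) {e : V × Fin q} (hv : e ≠ τ (v, j))
    (hw : e ≠ τ (w, j)) : removeFun τ v w j e = τ e := by
  rw [removeFun, if_neg, if_neg]
  · exact fun hh => hw (by rw [← hh, h.invol])
  · exact fun hh => hv (by rw [← hh, h.invol])

theorem IsDipole.removeFun_invol (h : IsDipole τ v w j) {e : V × Fin q} (hv : e.1 ≠ v)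
    (hw : e.1 ≠ w) : removeFun τ v w j (removeFun τ v w j e) = e := by
  by_cases h₁ : e = τ (v, j)
  · rw [h₁, h.removeFun_left, h.removeFun_right]
  by_cases h₂ : e = τ (w, j)
  · rw [h₂, h.removeFun_right, h.removeFun_left]
  rw [h.removeFun_of_ne h₁ h₂, h.removeFun_of_ne, h.invol]
  · exact fun hh => hv (congrArg Prod.fst (τ.injective hh))
  · exact fun hh => hw (congrArg Prod.fst (τ.injective hh))

theorem IsDipole.removeFun_fpf (h : IsDipole τ v w j) (e : V × Fin q) :
    removeFun τ v w j e ≠ e := by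
  by_cases h₁ : e = τ (v, j)
  · rw [h₁, h.removeFun_left]
    exact fun hh => h.ne.symm (congrArg Prod.fst (τ.injective hh))
  by_cases h₂ : e = τ (w, j)
  · rw [h₂, h.removeFun_right]
    exact fun hh => h.ne (congrArg Prod.fst (τ.injective hh))
  rw [h.removeFun_of_ne h₁ h₂]
  exact h.fpf e

/-- The pairing `removeFun`, on the darts of the remaining vertices. -/
def IsDipole.restrict (h : IsDipole τ v w j) (e : {u // u ≠ v ∧ u ≠ w} × Fin q) :
    {u // u ≠ v ∧ u ≠ w} × Fin q :=
  (⟨(removeFun τ v w j (dartMap Subtype.val e)).1, h.removeFun_fst e.1.2.1 e.1.2.2⟩,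
    (removeFun τ v w j (dartMap Subtype.val e)).2)

theorem IsDipole.dartMap_restrict (h : IsDipole τ v w j) (e : {u // u ≠ v ∧ u ≠ w} × Fin q) :
    dartMap Subtype.val (h.restrict e) = removeFun τ v w j (dartMap Subtype.val e) := rfl

theorem IsDipole.restrict_invol (h : IsDipole τ v w j) : Function.Involutive h.restrict :=
  fun e => dartMap_injective Subtype.val_injective (by
    rw [h.dartMap_restrict, h.dartMap_restrict, h.removeFun_invol e.1.2.1 e.1.2.2])

theorem IsDipole.restrict_fpf (h : IsDipole τ v w j) (e : {u // u ≠ v ∧ u ≠ w} × Fin q) :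
    h.restrict e ≠ e :=
  fun hh => h.removeFun_fpf _ ((h.dartMap_restrict e).symm.trans (congrArg _ hh))

end contraction

/-- The graph obtained by removing a dipole, before knowing that it is connected. -/
def PreGraph.removeDipole (H : PreGraph q) (v : H.V) (j : Fin q)
    (h : IsDipole H.ferm v (H.dis v) j) : PreGraph q where
  V := {u // u ≠ v ∧ u ≠ H.dis v}
  nonemptyV := ⟨⟨_, h.fst_ne⟩⟩
  ferm := h.restrict_invol.toPerm
  dis := H.dis.subtypePerm fun u => by
    rw [H.dis.injective.ne_iff, and_comm (a := u ≠ v),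
      ← H.dis.injective.ne_iff (x := u) (y := H.dis v), H.dis_invol, and_comm]
  ferm_invol := h.restrict_invol
  ferm_fpf := h.restrict_fpf
  dis_invol u := Subtype.ext (H.dis_invol u)
  dis_fpf u hu := H.dis_fpf u (congrArg Subtype.val hu)

theorem PreGraph.conn0_removeDipole (H : PreGraph q) (v : H.V) (j : Fin q)
    (h : IsDipole H.ferm v (H.dis v) j) (hc : H.Conn0) : (H.removeDipole v j h).Conn0 := by
  let M := H.removeDipole v j h
  let mkV : ∀ u, u ≠ v ∧ u ≠ H.dis v → M.V := fun u hu => ⟨u, hu⟩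
  have hone : ∀ u hu m u' hu', (removeFun H.ferm v (H.dis v) j (u, m)).1 = u' →
      Relation.ReflTransGen M.adj0 (mkV u hu) (mkV u' hu') := fun u hu m u' hu' h' =>
    .single ((M.adj0_iff _ _).2 ⟨m, _, Prod.ext (Subtype.ext h') rfl⟩)
  let a : M.V := mkV _ h.fst_ne
  let b : M.V := mkV _ h.symm.fst_ne.symm
  have hab : Relation.ReflTransGen M.adj0 a b :=
    hone _ _ (H.ferm (v, j)).2 _ _ (congrArg Prod.fst h.removeFun_left)
  have hba : Relation.ReflTransGen M.adj0 b a :=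
    hone _ _ (H.ferm (H.dis v, j)).2 _ _ (congrArg Prod.fst h.removeFun_right)
  let p : H.V → M.V := fun u =>
    if hv : u = v then a else if hw : u = H.dis v then b else mkV u ⟨hv, hw⟩
  have hpv : p v = a := dif_pos rfl
  have hpw : p (H.dis v) = b := (dif_neg h.ne.symm).trans (dif_pos rfl)
  have hp : ∀ u hu, p u = mkV u hu := fun u hu => (dif_neg hu.1).trans (dif_neg hu.2)
  have hstep : ∀ e : H.Dart, Relation.ReflTransGen M.adj0 (p e.1) (p (H.ferm e).1) := by
    intro e
    by_cases hev : e.1 = v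
    · by_cases heq : (H.ferm e).1 = H.dis v
      · rw [hev, heq, hpv, hpw]; exact hab
      · rw [h.eq_of_fst_eq hev heq, hpv, hp _ h.fst_ne]
    by_cases hew : e.1 = H.dis v
    · by_cases heq : (H.ferm e).1 = v
      · rw [hew, heq, hpv, hpw]; exact hba
      · rw [h.symm.eq_of_fst_eq hew heq, hpw, hp _ h.symm.fst_ne.symm]
    by_cases h₁ : e = H.ferm (v, j)
    · rw [h₁, H.ferm_invol, hpv, hp _ h.fst_ne]
    by_cases h₂ : e = H.ferm (H.dis v, j)
    · rw [h₂, H.ferm_invol, hpw, hp _ h.symm.fst_ne.symm]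
    have he := congrArg Prod.fst (h.removeFun_of_ne h₁ h₂)
    have hr := h.removeFun_fst hev hew
    rw [he] at hr
    rw [hp _ ⟨hev, hew⟩, hp _ hr]
    exact hone _ _ e.2 _ _ he
  have hpath : ∀ x y, Relation.ReflTransGen H.adj0 x y →
      Relation.ReflTransGen M.adj0 (p x) (p y) := by
    intro x y hxy
    induction hxy with
    | refl => exact .refl
    | @tail b c _ hbc ih =>
      obtain ⟨m, m', hm⟩ := (H.adj0_iff _ _).1 hbc
      have := hstep (b, m)
      rw [hm] at this
      exact ih.trans this
  intro x y
  have := hpath x.1 y.1 (hc _ _)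
  rwa [hp _ x.2, hp _ y.2] at this

/-- A dipole comes from the insertion of a melon. -/
theorem Graph.exists_isInsertion (G : Graph q) (v : G.V) (j : Fin q)
    (h : IsDipole G.ferm v (G.dis v) j) :
    ∃ (G₁ : Graph q) (ι : G₁.V → G.V) (d : G₁.V × Fin q),
      G₁.IsInsertion G v (G.dis v) ι d j := by
  have hfst : ∀ e : {u // u ≠ v ∧ u ≠ G.dis v} × Fin q, dartMap Subtype.val e = G.ferm (v, j) →
      dartMap Subtype.val (h.restrict e) = G.ferm (G.dis v, j) := fun e he => by
    rw [h.dartMap_restrict, he, h.removeFun_left]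
  refine ⟨⟨G.toPreGraph.removeDipole v j h, G.toPreGraph.conn0_removeDipole v j h G.conn⟩,
    Subtype.val, (⟨_, h.fst_ne⟩, (G.ferm (v, j)).2),
    { inj := Subtype.val_injective
      ne := h.ne
      range := fun u => ?_
      dis_new := rfl
      dis_old := fun _ => rfl
      ferm_left := G.ferm_invol _
      ferm_right := (hfst _ rfl).symm
      ferm_new := h.ferm_eq
      ferm_old := fun e h₁ h₂ => ?_ }⟩
  · have : (¬ ∃ u' : {u // u ≠ v ∧ u ≠ G.dis v}, u'.1 = u) ↔ u = v ∨ u = G.dis v := by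
      simp only [Subtype.exists, exists_prop, exists_eq_right]
      tauto
    exact this
  · refine (h.removeFun_of_ne (fun hh => h₁ ?_) fun hh => h₂ ?_).symm
    · exact dartMap_injective Subtype.val_injective hh
    · exact dartMap_injective Subtype.val_injective (hh.trans (hfst _ rfl).symm)

/-! ### The main theorem -/

theorem Graph.isMelonic_of_le_F (hq : 2 ≤ q) (G : Graph q)
    (hF : (q - 1) * G.nV + 2 ≤ 2 * G.F) : G.IsMelonic := by
  induction hn : G.nV using Nat.strong_induction_on generalizing G with
  | _ n ih =>
    obtain ⟨v, hv⟩ := G.toPreGraph.exists_dipole hq hF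
    by_cases hall : ∀ m, G.ferm (v, m) = (G.dis v, m)
    · exact ⟨G, G, G.isMin_of_ferm_eq v hall, .refl, .refl G⟩
    obtain ⟨j, hj⟩ := not_forall.1 hall
    have hdip : IsDipole G.ferm v (G.dis v) j :=
      { ne := (G.dis_fpf v).symm
        invol := G.ferm_invol
        fpf := G.ferm_fpf
        ferm_ne := hj
        ferm_eq := fun m hm => by
          by_contra hne
          exact hm (Finset.card_le_one.1 hv m (by simpa using hne) j (by simpa using hj)) }
    obtain ⟨G₁, ι, d, hins⟩ := G.exists_isInsertion v j hdip
    have hiso := hins.isomorphic hq (Equiv.refl _) (fun _ => rfl) (fun _ => rfl)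
      fun v => ⟨v, fun _ => rfl⟩
    have hnV := (hiso.nV_eq (by omega)).trans (nV_insertMelon hq _ _)
    have hF₁ := hiso.F_eq.trans (F_insertMelon hq _ _)
    refine IsMelonic.of_insertion hq hins (ih G₁.nV (by omega) G₁ ?_ rfl)
    rw [hnV, hF₁, mul_add] at hF
    omega

/-- For every integer `q ≥ 2`, an SYK graph `G` maximizes
the number of faces among SYK graphs with `|V(G)|` vertices if and only if
`G` is melonic. -/
theorem syk_max_faces_iff_melonic (q : ℕ) (hq : 2 ≤ q) (G : Graph q) :
    (∀ G' : Graph q, G'.toPreGraph.nV = G.toPreGraph.nV →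
        G'.toPreGraph.F ≤ G.toPreGraph.F) ↔ G.IsMelonic := by
  constructor
  · intro hmax
    obtain ⟨k, hk⟩ := G.even_nV
    have hpos := G.nV_pos
    obtain ⟨M, hM, hMn⟩ := exists_isMelonic_nV hq (k - 1)
    have hn : M.nV = G.nV := by omega
    have hFM := hM.two_mul_F hq
    rw [hn] at hFM
    have := hmax M hn
    exact G.isMelonic_of_le_F hq (by omega)
  · intro hG G' hn
    by_contra! hlt
    have hF := hG.two_mul_F hq
    have hF' := (G'.isMelonic_of_le_F hq (by rw [hn]; omega)).two_mul_F hq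
    rw [hn] at hF'
    omega

end SYK
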